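/- arXiv:1812.03093 — 4 statements merged into one kernel-verified Lean document; each statement's English description precedes it below -/
import Mathlib

section
/- Let (X,M,*) be a fuzzy metric space. A function f : X → ℝ is R-uniformly continuous if and only if for every pair of sequences (x_n), (y_n) in X satisfying M(x_n, y_n, s) → 1 for all s > 0, one has |f(x_n) − f(y_n)| → 0. -/
open Filter Topology Set

/-- A fuzzy metric space in the sense of George and Veeramani: a continuous
t-norm `star` on `[0,1]` together with a fuzzy set `M` on `X × X × (0,∞)`. -/
structure FuzzyMetric (X : Type*) where
  M : X → X → ℝ → ℝ
  star : ℝ → ℝ → ℝ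
  star_mem : ∀ a ∈ Set.Icc (0:ℝ) 1, ∀ b ∈ Set.Icc (0:ℝ) 1, star a b ∈ Set.Icc (0:ℝ) 1
  star_comm : ∀ a ∈ Set.Icc (0:ℝ) 1, ∀ b ∈ Set.Icc (0:ℝ) 1, star a b = star b a
  star_assoc : ∀ a ∈ Set.Icc (0:ℝ) 1, ∀ b ∈ Set.Icc (0:ℝ) 1, ∀ c ∈ Set.Icc (0:ℝ) 1,
    star (star a b) c = star a (star b c)
  star_one : ∀ a ∈ Set.Icc (0:ℝ) 1, star a 1 = a
  star_mono : ∀ a b c d : ℝ, a ∈ Set.Icc (0:ℝ) 1 → b ∈ Set.Icc (0:ℝ) 1 →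
    c ∈ Set.Icc (0:ℝ) 1 → d ∈ Set.Icc (0:ℝ) 1 → a ≤ b → c ≤ d → star a c ≤ star b d
  star_continuous : ContinuousOn (fun p : ℝ × ℝ => star p.1 p.2)
    (Set.Icc (0:ℝ) 1 ×ˢ Set.Icc (0:ℝ) 1)
  M_pos : ∀ x y t, 0 < t → 0 < M x y t
  M_le_one : ∀ x y t, 0 < t → M x y t ≤ 1
  M_eq_one_iff : ∀ x y t, 0 < t → (M x y t = 1 ↔ x = y)
  M_symm : ∀ x y t, 0 < t → M x y t = M y x t
  M_triangle : ∀ x y z t s, 0 < t → 0 < s → star (M x y t) (M y z s) ≤ M x z (t + s)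
  M_continuousOn : ∀ x y, ContinuousOn (M x y) (Set.Ioi (0:ℝ))

namespace FuzzyMetric

variable {X : Type*}

/-- The open ball `B(x,r,t)`. -/
def ball (F : FuzzyMetric X) (x : X) (r t : ℝ) : Set X := {y | 1 - r < F.M x y t}

/-- The topology `τ_M` induced by the fuzzy metric (the balls form a base for it). -/
def topology (F : FuzzyMetric X) : TopologicalSpace X :=
  TopologicalSpace.generateFrom
    {s | ∃ x : X, ∃ r t : ℝ, r ∈ Set.Ioo (0:ℝ) 1 ∧ 0 < t ∧ s = F.ball x r t}

/-- `f : X → ℝ` is `ℝ`-uniformly continuous. -/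
def RUniformlyContinuous (F : FuzzyMetric X) (f : X → ℝ) : Prop :=
  ∀ ε > (0:ℝ), ∃ r ∈ Set.Ioo (0:ℝ) 1, ∃ s > (0:ℝ),
    ∀ x y : X, 1 - r < F.M x y s → |f x - f y| < ε

/-- The Lebesgue property: every open cover is refined by the family of balls of
some fixed radius `r` and parameter `t`. -/
def Lebesgue (F : FuzzyMetric X) : Prop :=
  ∀ 𝒢 : Set (Set X), (∀ G ∈ 𝒢, F.topology.IsOpen G) → ⋃₀ 𝒢 = Set.univ →
    ∃ r ∈ Set.Ioo (0:ℝ) 1, ∃ t > (0:ℝ), ∀ x : X, ∃ G ∈ 𝒢, F.ball x r t ⊆ G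

/-- A set `A ⊆ X` is fuzzy uniformly discrete. -/
def UniformlyDiscrete (F : FuzzyMetric X) (A : Set X) : Prop :=
  ∃ r ∈ Set.Ioo (0:ℝ) 1, ∃ s > (0:ℝ), ∀ x ∈ A, ∀ y ∈ A, x ≠ y → F.M x y s < 1 - r

/-- The set `X'` of accumulation points of `(X, τ_M)`. -/
def derivedSet (F : FuzzyMetric X) : Set X :=
  {x | ∀ U : Set X, F.topology.IsOpen U → x ∈ U → ∃ y ∈ U, y ≠ x}

/-- A sequence is Cauchy in the fuzzy metric. -/
def IsCauchy (F : FuzzyMetric X) (u : ℕ → X) : Prop :=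
  ∀ ε ∈ Set.Ioo (0:ℝ) 1, ∀ t > (0:ℝ), ∃ k : ℕ, ∀ m ≥ k, ∀ n ≥ k, 1 - ε < F.M (u m) (u n) t

/-- Sequential compactness: every sequence has a convergent subsequence. -/
def SeqCompact (F : FuzzyMetric X) : Prop :=
  ∀ u : ℕ → X, ∃ x : X, ∃ φ : ℕ → ℕ, StrictMono φ ∧
    Filter.Tendsto (u ∘ φ) Filter.atTop (@nhds X F.topology x)

end FuzzyMetric
theorem FuzzyMetric.M_monotoneOn {X : Type*} (F : FuzzyMetric X) (x y : X) :
    MonotoneOn (F.M x y) (Set.Ioi 0) := by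
  intro s hs t _ hst
  rcases hst.eq_or_lt with rfl | hlt
  · exact le_rfl
  have hs : 0 < s := hs
  have hd : 0 < t - s := sub_pos.2 hlt
  have h := F.M_triangle x y y s (t - s) hs hd
  rwa [(F.M_eq_one_iff y y (t - s) hd).2 rfl,
    F.star_one _ ⟨(F.M_pos x y s hs).le, F.M_le_one x y s hs⟩, add_sub_cancel] at h

/-- Lemma 3 (Lemma `lemxy`): `f : X → ℝ` is `ℝ`-uniformly continuous iff for all
sequences `(x_n)`, `(y_n)` with `M(x_n,y_n,s) → 1` for every `s > 0` one has
`|f(x_n) - f(y_n)| → 0`. -/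
theorem rUniformlyContinuous_iff_seq {X : Type*} [Nonempty X] (F : FuzzyMetric X) (f : X → ℝ) :
    F.RUniformlyContinuous f ↔
      ∀ x y : ℕ → X,
        (∀ s > (0:ℝ), Filter.Tendsto (fun n => F.M (x n) (y n) s) Filter.atTop (nhds 1)) →
        Filter.Tendsto (fun n => |f (x n) - f (y n)|) Filter.atTop (nhds 0) := by
  constructor
  · intro hf x y hxy
    rw [Metric.tendsto_nhds]
    intro ε hε
    obtain ⟨r, hr, s, hs, h⟩ := hf ε hε
    filter_upwards [(hxy s hs).eventually_const_lt (sub_lt_self 1 hr.1)] with n hn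
    simpa using h _ _ hn
  · intro h
    by_contra hf
    simp only [FuzzyMetric.RUniformlyContinuous] at hf
    push Not at hf
    obtain ⟨ε, hε, hf⟩ := hf
    have hpos (n : ℕ) : (0 : ℝ) < 1 / ((n : ℝ) + 2) := by positivity
    have hlt (n : ℕ) : 1 / ((n : ℝ) + 2) < 1 := by
      rw [div_lt_one (by positivity)]
      linarith [n.cast_nonneg (α := ℝ)]
    have hlim : Tendsto (fun n : ℕ => 1 / ((n : ℝ) + 2)) atTop (𝓝 0) :=
      tendsto_const_nhds.div_atTop
        (tendsto_atTop_add_const_right _ _ tendsto_natCast_atTop_atTop)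
    choose x y hM hxy using fun n : ℕ =>
      hf (1 / ((n : ℝ) + 2)) ⟨hpos n, hlt n⟩ (1 / ((n : ℝ) + 2)) (hpos n)
    have hconv : Tendsto (fun n => |f (x n) - f (y n)|) atTop (𝓝 0) := by
      refine h x y fun s hs => ?_
      refine tendsto_of_tendsto_of_tendsto_of_le_of_le'
        (by simpa only [sub_zero] using hlim.const_sub 1) tendsto_const_nhds ?_
        (Eventually.of_forall fun n => F.M_le_one _ _ s hs)
      filter_upwards [hlim.eventually_lt_const hs] with n hn
      exact (hM n).le.trans (F.M_monotoneOn _ _ (hpos n) hs hn.le)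
    exact hε.not_ge (ge_of_tendsto' hconv hxy)
end

section
/- A fuzzy metric space (X,M,*) is sequentially compact if and only if it is compact. -/
open Filter Topology Set

theorem exists_lt_apply_one_sub {f : ℝ → ℝ} (hf : ContinuousOn f (Icc 0 1)) {c : ℝ}
    (hc : c < f 1) : ∃ δ ∈ Ioo (0:ℝ) 1, c < f (1 - δ) := by
  have h1 : ∀ᶠ x in 𝓝[Icc 0 1] (1:ℝ), c < f x :=
    (hf 1 (by simp)).eventually_const_lt hc
  have h2 : ∀ᶠ x in 𝓝[<] (1:ℝ), c < f x :=
    nhdsWithin_le_of_mem (Icc_mem_nhdsLT one_pos) h1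
  obtain ⟨x, hx, hx'⟩ := (h2.and (Ioo_mem_nhdsLT one_pos)).exists
  exact ⟨1 - x, ⟨by linarith [hx'.2], by linarith [hx'.1]⟩, by simpa using hx⟩

namespace FuzzyMetric

variable {X : Type*} (F : FuzzyMetric X)

theorem M_mem_Icc (x y : X) {t : ℝ} (ht : 0 < t) : F.M x y t ∈ Icc (0:ℝ) 1 :=
  ⟨(F.M_pos x y t ht).le, F.M_le_one x y t ht⟩

theorem M_self (x : X) {t : ℝ} (ht : 0 < t) : F.M x x t = 1 :=
  (F.M_eq_one_iff x x t ht).2 rfl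

theorem M_mono (x y : X) {s t : ℝ} (hs : 0 < s) (hst : s ≤ t) : F.M x y s ≤ F.M x y t := by
  rcases hst.eq_or_lt with rfl | h
  · rfl
  · have := F.M_triangle x y y s (t - s) hs (sub_pos.2 h)
    rwa [F.M_self y (sub_pos.2 h), F.star_one _ (F.M_mem_Icc x y hs),
      add_sub_cancel] at this

theorem exists_lt_star_one_sub {a c : ℝ} (ha : a ∈ Icc (0:ℝ) 1) (hc : c < a) :
    ∃ δ ∈ Ioo (0:ℝ) 1, c < F.star a (1 - δ) := by
  refine exists_lt_apply_one_sub (f := fun b => F.star a b) ?_ (by rwa [F.star_one a ha])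
  exact F.star_continuous.comp (f := fun b => (a, b)) (by fun_prop) fun b hb => ⟨ha, hb⟩

theorem exists_lt_star_one_sub_self {c : ℝ} (hc : c < 1) :
    ∃ δ ∈ Ioo (0:ℝ) 1, c < F.star (1 - δ) (1 - δ) := by
  refine exists_lt_apply_one_sub (f := fun b => F.star b b) ?_
    (by rwa [F.star_one 1 (by simp)])
  exact F.star_continuous.comp (f := fun b => (b, b)) (by fun_prop) fun b hb => ⟨hb, hb⟩

/-- The pairs of points that are close at scale `ε`. -/
def entourage (ε : ℝ) : Set (X × X) := {p | 1 - ε < F.M p.1 p.2 ε}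

theorem entourage_mono {δ ε : ℝ} (hδ : 0 < δ) (h : δ ≤ ε) : F.entourage δ ⊆ F.entourage ε := by
  intro p hp
  have hp' : 1 - δ < F.M p.1 p.2 δ := hp
  show 1 - ε < F.M p.1 p.2 ε
  linarith [F.M_mono p.1 p.2 hδ h]

/-- The filter generated by the entourages of the fuzzy metric. -/
def uniformityFilter : Filter (X × X) := ⨅ n : ℕ, 𝓟 (F.entourage (1 / ((n : ℝ) + 1)))

instance : F.uniformityFilter.IsCountablyGenerated := by
  unfold uniformityFilter
  infer_instance

theorem hasBasis_uniformityFilter :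
    F.uniformityFilter.HasBasis (fun ε : ℝ => 0 < ε) F.entourage := by
  have hanti : Antitone fun n : ℕ => F.entourage (1 / ((n : ℝ) + 1)) := fun m n h =>
    F.entourage_mono Nat.one_div_pos_of_nat (Nat.one_div_le_one_div h)
  refine (hasBasis_iInf_principal hanti.directed_ge).to_hasBasis
    (fun n _ => ⟨_, Nat.one_div_pos_of_nat, Subset.rfl⟩) fun ε hε => ?_
  obtain ⟨n, hn⟩ := exists_nat_one_div_lt hε
  exact ⟨n, trivial, F.entourage_mono Nat.one_div_pos_of_nat hn.le⟩

theorem exists_comp_entourage_subset {ε : ℝ} (hε : 0 < ε) :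
    ∃ η > 0, ∀ x y z, (x, y) ∈ F.entourage η → (y, z) ∈ F.entourage η →
      (x, z) ∈ F.entourage ε := by
  obtain ⟨δ, hδ, h⟩ := F.exists_lt_star_one_sub_self (c := 1 - ε) (by linarith)
  have hη : 0 < min δ (ε / 2) := lt_min hδ.1 (half_pos hε)
  refine ⟨min δ (ε / 2), hη, fun x y z hxy hyz => ?_⟩
  have hxy' : 1 - min δ (ε / 2) < F.M x y (min δ (ε / 2)) := hxy
  have hyz' : 1 - min δ (ε / 2) < F.M y z (min δ (ε / 2)) := hyz
  have hle := min_le_left δ (ε / 2)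
  have hδ' : 1 - δ ∈ Icc (0:ℝ) 1 := ⟨by linarith [hδ.2], by linarith [hδ.1]⟩
  calc 1 - ε < F.star (1 - δ) (1 - δ) := h
    _ ≤ F.star (F.M x y (min δ (ε / 2))) (F.M y z (min δ (ε / 2))) :=
      F.star_mono _ _ _ _ hδ' (F.M_mem_Icc x y hη) hδ' (F.M_mem_Icc y z hη)
        (by linarith) (by linarith)
    _ ≤ F.M x z (min δ (ε / 2) + min δ (ε / 2)) := F.M_triangle x y z _ _ hη hη
    _ ≤ F.M x z ε := F.M_mono x z (by linarith) (by linarith [min_le_right δ (ε / 2)])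

theorem exists_entourage_subset_ball {x y : X} {r t : ℝ} (ht : 0 < t) (hy : y ∈ F.ball x r t) :
    ∃ ε > 0, ∀ z, (y, z) ∈ F.entourage ε → z ∈ F.ball x r t := by
  have hev : ∀ᶠ s in 𝓝 t, 1 - r < F.M x y s :=
    ((F.M_continuousOn x y).continuousAt (Ioi_mem_nhds ht)).eventually_const_lt hy
  obtain ⟨s, hs, hs'⟩ :=
    ((hev.filter_mono nhdsWithin_le_nhds).and (Ioo_mem_nhdsLT ht)).exists
  have hst : 0 < t - s := sub_pos.2 hs'.2
  have hM := F.M_mem_Icc x y hs'.1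
  obtain ⟨δ, hδ, h⟩ := F.exists_lt_star_one_sub hM hs
  have hη : 0 < min δ (t - s) := lt_min hδ.1 hst
  refine ⟨min δ (t - s), hη, fun z hz => ?_⟩
  have hz' : 1 - min δ (t - s) < F.M y z (min δ (t - s)) := hz
  have hmono := F.M_mono y z hη (min_le_right δ (t - s))
  calc 1 - r < F.star (F.M x y s) (1 - δ) := h
    _ ≤ F.star (F.M x y s) (F.M y z (t - s)) :=
      F.star_mono _ _ _ _ hM hM ⟨by linarith [hδ.2], by linarith [hδ.1]⟩
        (F.M_mem_Icc y z hst) le_rfl (by linarith [min_le_left δ (t - s)])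
    _ ≤ F.M x z (s + (t - s)) := F.M_triangle x y z _ _ hs'.1 hst
    _ = F.M x z t := by rw [add_sub_cancel]

theorem nhds_eq_comap_uniformityFilter (x : X) :
    @nhds X F.topology x = comap (Prod.mk x) F.uniformityFilter := by
  have hbasis := F.hasBasis_uniformityFilter.comap (Prod.mk x)
  rw [topology, TopologicalSpace.nhds_generateFrom]
  apply le_antisymm
  · refine hbasis.ge_iff.2 fun ε hε => ?_
    have hη : 0 < min ε (1 / 2) := lt_min hε (by norm_num)
    have hx : x ∈ F.ball x (min ε (1 / 2)) (min ε (1 / 2)) := by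
      show 1 - min ε (1 / 2) < F.M x x (min ε (1 / 2))
      rw [F.M_self x hη]
      linarith
    have hη1 : min ε (1 / 2) < 1 := (min_le_right _ _).trans_lt (by norm_num)
    exact mem_of_superset
      (mem_iInf_of_mem _ (mem_iInf_of_mem ⟨hx, x, _, _, ⟨hη, hη1⟩, hη, rfl⟩ (mem_principal_self _)))
      fun z hz => F.entourage_mono hη (min_le_left _ _) hz
  · refine le_iInf₂ fun s hs => le_principal_iff.2 ?_
    obtain ⟨hxs, y, r, t, -, ht, rfl⟩ := hs
    obtain ⟨ε, hε, h⟩ := F.exists_entourage_subset_ball ht hxs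
    exact hbasis.mem_iff.2 ⟨ε, hε, fun z hz => h z hz⟩

/-- The uniform structure of a fuzzy metric space, whose topology is `F.topology`. -/
abbrev uniformSpace : UniformSpace X where
  toTopologicalSpace := F.topology
  uniformity := F.uniformityFilter
  symm := by
    refine (F.hasBasis_uniformityFilter.tendsto_iff F.hasBasis_uniformityFilter).2
      fun ε hε => ⟨ε, hε, fun p hp => ?_⟩
    show 1 - ε < F.M p.2 p.1 ε
    rw [F.M_symm _ _ _ hε]
    exact hp
  comp := by
    refine F.hasBasis_uniformityFilter.ge_iff.2 fun ε hε => ?_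
    obtain ⟨η, hη, h⟩ := F.exists_comp_entourage_subset hε
    refine mem_of_superset (mem_lift' (F.hasBasis_uniformityFilter.mem_of_mem hη)) ?_
    rintro ⟨x, z⟩ ⟨y, hxy, hyz⟩
    exact h x y z hxy hyz
  nhds_eq_comap_uniformity := F.nhds_eq_comap_uniformityFilter

end FuzzyMetric

/-- Lemma (`lemscom`): a fuzzy metric space is sequentially compact iff it is compact. -/
theorem seqCompact_iff_compact {X : Type*} [Nonempty X] (F : FuzzyMetric X) :
    F.SeqCompact ↔ @CompactSpace X F.topology := by
  let _ := F.uniformSpace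
  have : (uniformity X).IsCountablyGenerated :=
    inferInstanceAs F.uniformityFilter.IsCountablyGenerated
  have h : CompactSpace X ↔ SeqCompactSpace X := compactSpace_iff_seqCompactSpace
  rw [h, seqCompactSpace_iff]
  simp [FuzzyMetric.SeqCompact, IsSeqCompact]
end

section
/- A sequentially compact fuzzy metric space (X,M,*) is precompact: for every r ∈ (0,1) and t > 0 there is a finite subset A of X such that X = ⋃_{a∈A} B(a,r,t). -/
open Filter Topology Set

namespace FuzzyMetric

variable {X : Type*}

/-- Near `1` the t-norm of a fuzzy metric takes values near `1`. -/
theorem exists_lt_star_self (F : FuzzyMetric X) {r : ℝ} (hr : 0 < r) :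
    ∃ δ ∈ Set.Ioo (0:ℝ) 1, 1 - r < F.star (1 - δ) (1 - δ) := by
  have h1 : (1:ℝ) ∈ Set.Icc (0:ℝ) 1 := by simp
  have hc := F.star_continuous (1, 1) ⟨h1, h1⟩
  rw [Metric.continuousWithinAt_iff] at hc
  obtain ⟨ε, hε, H⟩ := hc r hr
  have hδ : 0 < min (ε / 2) (1 / 2) := by positivity
  have hδε := min_le_left (ε / 2) (1 / 2)
  have hδ2 := min_le_right (ε / 2) (1 / 2)
  set δ := min (ε / 2) (1 / 2)
  have hmem : 1 - δ ∈ Set.Icc (0:ℝ) 1 := ⟨by linarith, by linarith⟩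
  refine ⟨δ, ⟨hδ, by linarith⟩, ?_⟩
  have hd : dist ((1 - δ, 1 - δ) : ℝ × ℝ) (1, 1) < ε := by
    simp only [Prod.dist_eq, Real.dist_eq, max_self]
    rw [abs_lt]
    constructor <;> linarith
  have := H (Set.mk_mem_prod hmem hmem) hd
  simp only [F.star_one 1 h1, Real.dist_eq, abs_lt] at this
  linarith

theorem isOpen_ball (F : FuzzyMetric X) (x : X) {r t : ℝ} (hr : r ∈ Set.Ioo (0:ℝ) 1)
    (ht : 0 < t) : F.topology.IsOpen (F.ball x r t) :=
  TopologicalSpace.isOpen_generateFrom_of_mem ⟨x, r, t, hr, ht, rfl⟩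

theorem mem_ball_self (F : FuzzyMetric X) (x : X) {r t : ℝ} (hr : 0 < r) (ht : 0 < t) :
    x ∈ F.ball x r t := by
  change 1 - r < F.M x x t
  rw [(F.M_eq_one_iff x x t ht).2 rfl]
  linarith

theorem mem_Icc (F : FuzzyMetric X) (x y : X) {t : ℝ} (ht : 0 < t) :
    F.M x y t ∈ Set.Icc (0:ℝ) 1 :=
  ⟨(F.M_pos x y t ht).le, F.M_le_one x y t ht⟩

/-- Two points of a ball of radius `δ` and parameter `t / 2` are close at parameter `t`. -/
theorem mem_ball_of_mem_ball_half (F : FuzzyMetric X) {x y z : X} {r δ t : ℝ}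
    (hδ : δ ∈ Set.Ioo (0:ℝ) 1) (hr : 1 - r < F.star (1 - δ) (1 - δ)) (ht : 0 < t)
    (hy : y ∈ F.ball x δ (t / 2)) (hz : z ∈ F.ball x δ (t / 2)) : z ∈ F.ball y r t := by
  have ht2 : 0 < t / 2 := half_pos ht
  have hmem : 1 - δ ∈ Set.Icc (0:ℝ) 1 := ⟨by linarith [hδ.2], by linarith [hδ.1]⟩
  have hy' : 1 - δ ≤ F.M y x (t / 2) := by
    rw [F.M_symm y x _ ht2]
    exact le_of_lt hy
  calc 1 - r < F.star (1 - δ) (1 - δ) := hr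
    _ ≤ F.star (F.M y x (t / 2)) (F.M x z (t / 2)) :=
      F.star_mono _ _ _ _ hmem (F.mem_Icc _ _ ht2) hmem (F.mem_Icc _ _ ht2) hy' (le_of_lt hz)
    _ ≤ F.M y z (t / 2 + t / 2) := F.M_triangle _ _ _ _ _ ht2 ht2
    _ = F.M y z t := by rw [add_halves]

end FuzzyMetric

/-- A sequentially compact fuzzy metric space is precompact: for every `r ∈ (0,1)`,
`t > 0` there is a finite `A ⊆ X` with `X = ⋃_{a ∈ A} B(a,r,t)`. -/
theorem seqCompact_precompact {X : Type*} [Nonempty X] (F : FuzzyMetric X)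
    (h : F.SeqCompact) :
    ∀ r ∈ Set.Ioo (0:ℝ) 1, ∀ t > (0:ℝ),
      ∃ A : Finset X, ∀ x : X, ∃ a ∈ A, x ∈ F.ball a r t := by
  intro r hr t ht
  by_contra! hA
  obtain ⟨u, -, hu⟩ := exists_seq_of_forall_finset_exists (fun _ : X => True)
    (fun a x => x ∉ F.ball a r t) fun A _ => (hA A).imp fun _ hx => ⟨trivial, hx⟩
  obtain ⟨x, φ, hφ, hlim⟩ := h u
  obtain ⟨δ, hδ, hδr⟩ := F.exists_lt_star_self hr.1
  have hev : ∀ᶠ n in atTop, (u ∘ φ) n ∈ F.ball x δ (t / 2) :=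
    hlim (@IsOpen.mem_nhds X F.topology _ _ (F.isOpen_ball x hδ (half_pos ht))
      (F.mem_ball_self x hδ.1 (half_pos ht)))
  obtain ⟨N, hN⟩ := eventually_atTop.1 hev
  exact hu (φ N) (φ (N + 1)) (hφ N.lt_succ_self)
    (F.mem_ball_of_mem_ball_half hδ hδr ht (hN N le_rfl) (hN (N + 1) N.le_succ))
end

section
/- For a fuzzy metric space (X,M,*), every real-valued continuous function on (X,τ_M) is R-uniformly continuous if and only if every bounded real-valued continuous function on (X,τ_M) is R-uniformly continuous. -/
open Filter Topology Set

theorem FuzzyMetric.M_mono_s5 {X : Type*} (F : FuzzyMetric X) (x y : X) {s t : ℝ} (hs : 0 < s)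
    (hst : s ≤ t) : F.M x y s ≤ F.M x y t := by
  rcases hst.eq_or_lt with rfl | hlt
  · exact le_rfl
  have h := F.M_triangle x y y s (t - s) hs (sub_pos.2 hlt)
  rwa [(F.M_eq_one_iff y y (t - s) (sub_pos.2 hlt)).2 rfl,
    F.star_one _ ⟨(F.M_pos x y s hs).le, F.M_le_one x y s hs⟩, add_sub_cancel] at h

/-- Failure of `ℝ`-uniform continuity is witnessed by a pair of sequences. -/
theorem FuzzyMetric.exists_seq_of_not_rUniformlyContinuous {X : Type*} (F : FuzzyMetric X)
    {f : X → ℝ} (hf : ¬ F.RUniformlyContinuous f) :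
    ∃ ε > 0, ∃ x y : ℕ → X, (∀ n, ε ≤ |f (x n) - f (y n)|) ∧
      ∀ r > 0, ∀ s > 0, ∀ᶠ n in atTop, 1 - r < F.M (x n) (y n) s := by
  unfold FuzzyMetric.RUniformlyContinuous at hf
  push Not at hf
  obtain ⟨ε, hε, H⟩ := hf
  have hpos (n : ℕ) : (0 : ℝ) < 1 / ((n + 1 : ℕ) + 1) := Nat.one_div_pos_of_nat
  have hlt (n : ℕ) : (1 : ℝ) / ((n + 1 : ℕ) + 1) < 1 := by
    rw [div_lt_one (by positivity)]
    push_cast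
    linarith [n.cast_nonneg (α := ℝ)]
  choose x y hM hfxy using fun n : ℕ ↦ H _ ⟨hpos n, hlt n⟩ _ (hpos n)
  refine ⟨ε, hε, x, y, hfxy, fun r hr s hs ↦ ?_⟩
  have hlim := tendsto_one_div_add_atTop_nhds_zero_nat (𝕜 := ℝ) |>.comp (tendsto_add_atTop_nat 1)
  filter_upwards [hlim.eventually_lt_const hr, hlim.eventually_lt_const hs] with n hnr hns
  simp only [Function.comp_apply] at hnr hns
  linarith [hM n, F.M_mono_s5 (x n) (y n) (hpos n) hns.le]

/-- Clamping to a large interval keeps `a` and `b` apart when `a` is bounded. -/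
theorem le_abs_clamp_sub_clamp {a b C ε : ℝ} (hε : 0 < ε) (ha : |a| ≤ C) (hab : ε ≤ |a - b|) :
    ε ≤ |max (-(C + ε)) (min (C + ε) a) - max (-(C + ε)) (min (C + ε) b)| := by
  obtain ⟨h₁, h₂⟩ := abs_le.1 ha
  rw [min_eq_right (by linarith : a ≤ C + ε), max_eq_right (by linarith : -(C + ε) ≤ a)]
  rcases le_total (C + ε) b with hb | hb
  · rw [min_eq_left hb, max_eq_right (by linarith), le_abs]
    exact Or.inr (by linarith)
  · rw [min_eq_right hb]
    rcases le_total (-(C + ε)) b with hb' | hb'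
    · rwa [max_eq_right hb']
    · rw [max_eq_left hb', le_abs]
      exact Or.inl (by linarith)

theorem isClosed_range_of_tendsto_cocompact {u : ℕ → ℝ} (hu : Tendsto u atTop (cocompact ℝ)) :
    IsClosed (range u) := by
  refine (isProperMap_iff_tendsto_cocompact.2
    ⟨continuous_of_discreteTopology, ?_⟩).isClosedMap.isClosed_range
  rwa [cocompact_eq_cofinite, Nat.cofinite_eq_atTop]

/-- Two real sequences tending to infinity and differing at every index can be separated along
a subsequence by a bounded continuous function. -/
theorem exists_continuous_separating_of_tendsto_cocompact {a b : ℕ → ℝ} (hab : ∀ n, a n ≠ b n)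
    (ha : Tendsto a atTop (cocompact ℝ)) (hb : Tendsto b atTop (cocompact ℝ)) :
    ∃ h : ℝ → ℝ, Continuous h ∧ (∃ C, ∀ x, |h x| ≤ C) ∧
      ∃ᶠ n in atTop, 1 ≤ |h (a n) - h (b n)| := by
  have hne {u : ℕ → ℝ} (hu : Tendsto u atTop (cocompact ℝ)) (c : ℝ) : ∀ᶠ n in atTop, u n ≠ c :=
    hu.eventually (isCompact_singleton (x := c)).compl_mem_cocompact
  obtain ⟨φ, -, hφ⟩ := exists_seq_of_forall_finset_exists (fun _ : ℕ ↦ True)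
    (fun m n ↦ m < n ∧ a n ≠ b m ∧ b n ≠ a m) fun s _ ↦ by
      have : ∀ᶠ n in atTop, ∀ m ∈ s, m < n ∧ a n ≠ b m ∧ b n ≠ a m :=
        (eventually_all_finset s).2 fun m _ ↦
          (eventually_gt_atTop m).and ((hne ha (b m)).and (hne hb (a m)))
      obtain ⟨n, hn⟩ := this.exists
      exact ⟨n, trivial, hn⟩
  have hφ_mono : StrictMono φ := fun m n hmn ↦ (hφ m n hmn).1
  have hdisj : Disjoint (range (a ∘ φ)) (range (b ∘ φ)) := by
    rw [Set.disjoint_left]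
    rintro _ ⟨m, rfl⟩ ⟨n, hmn⟩
    rcases lt_trichotomy m n with h | rfl | h
    · exact (hφ m n h).2.2 hmn
    · exact hab _ hmn.symm
    · exact (hφ n m h).2.1 hmn.symm
  obtain ⟨g, hg₀, hg₁, hg⟩ := exists_continuous_zero_one_of_isClosed
    (isClosed_range_of_tendsto_cocompact (ha.comp hφ_mono.tendsto_atTop))
    (isClosed_range_of_tendsto_cocompact (hb.comp hφ_mono.tendsto_atTop)) hdisj
  refine ⟨g, g.continuous, ⟨1, fun x ↦ abs_le.2 ⟨by linarith [(hg x).1], (hg x).2⟩⟩, ?_⟩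
  refine hφ_mono.tendsto_atTop.frequently (Frequently.of_forall fun n ↦ ?_)
  have h₀ : g (a (φ n)) = 0 := hg₀ ⟨n, rfl⟩
  have h₁ : g (b (φ n)) = 1 := hg₁ ⟨n, rfl⟩
  simp [h₀, h₁]

/-- Two real sequences at distance bounded below can be kept apart, infinitely often, by a bounded
continuous function. -/
theorem exists_bounded_continuous_frequently_le_abs_sub {a b : ℕ → ℝ} {ε : ℝ} (hε : 0 < ε)
    (hab : ∀ n, ε ≤ |a n - b n|) :
    ∃ h : ℝ → ℝ, Continuous h ∧ (∃ C, ∀ x, |h x| ≤ C) ∧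
      ∃ δ > 0, ∃ᶠ n in atTop, δ ≤ |h (a n) - h (b n)| := by
  have hclamp {u v : ℕ → ℝ} (huv : ∀ n, ε ≤ |u n - v n|)
      (hu : ¬ Tendsto u atTop (cocompact ℝ)) :
      ∃ h : ℝ → ℝ, Continuous h ∧ (∃ C, ∀ x, |h x| ≤ C) ∧
        ∃ δ > 0, ∃ᶠ n in atTop, δ ≤ |h (u n) - h (v n)| := by
    rw [← Metric.cobounded_eq_cocompact, ← tendsto_norm_atTop_iff_cobounded, tendsto_atTop] at hu
    push Not at hu
    obtain ⟨C, hC⟩ := hu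
    have hC₀ : 0 ≤ C := by
      obtain ⟨n, hn⟩ := hC.exists
      exact (norm_nonneg _).trans hn.le
    refine ⟨fun x ↦ max (-(C + ε)) (min (C + ε) x), by fun_prop, ⟨C + ε, fun x ↦ ?_⟩, ε, hε, ?_⟩
    · exact abs_le.2 ⟨le_max_left _ _, max_le (by linarith) (min_le_left _ _)⟩
    · exact hC.mono fun n hn ↦ le_abs_clamp_sub_clamp hε hn.le (huv n)
  by_cases ha : Tendsto a atTop (cocompact ℝ)
  · by_cases hb : Tendsto b atTop (cocompact ℝ)
    · have hne (n : ℕ) : a n ≠ b n := fun h ↦ by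
        have := hab n
        rw [h, sub_self, abs_zero] at this
        linarith
      obtain ⟨h, hc, hbdd, hsep⟩ := exists_continuous_separating_of_tendsto_cocompact hne ha hb
      exact ⟨h, hc, hbdd, 1, one_pos, hsep⟩
    · obtain ⟨h, hc, hbdd, δ, hδ, hsep⟩ := hclamp (fun n ↦ abs_sub_comm (a n) (b n) ▸ hab n) hb
      exact ⟨h, hc, hbdd, δ, hδ, hsep.mono fun n hn ↦ abs_sub_comm (h (b n)) _ ▸ hn⟩
  · exact hclamp hab ha

/-- Every real-valued continuous function on `(X, τ_M)` is `ℝ`-uniformly continuous iff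
every bounded real-valued continuous function on `(X, τ_M)` is `ℝ`-uniformly continuous. -/
theorem continuous_rUC_iff_bounded_continuous_rUC {X : Type*} [Nonempty X]
    (F : FuzzyMetric X) :
    (∀ f : X → ℝ, @Continuous X ℝ F.topology _ f → F.RUniformlyContinuous f) ↔
      (∀ f : X → ℝ, @Continuous X ℝ F.topology _ f → (∃ C : ℝ, ∀ x : X, |f x| ≤ C) →
        F.RUniformlyContinuous f) := by
  refine ⟨fun H f hf _ ↦ H f hf, fun H f hf ↦ ?_⟩
  by_contra hnot
  obtain ⟨ε, hε, x, y, hxy, hM⟩ := F.exists_seq_of_not_rUniformlyContinuous hnot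
  obtain ⟨h, hh, ⟨C, hC⟩, δ, hδ, hsep⟩ :=
    exists_bounded_continuous_frequently_le_abs_sub hε hxy
  obtain ⟨r, hr, s, hs, hrs⟩ :=
    H (h ∘ f) (@Continuous.comp _ _ _ F.topology _ _ _ _ hh hf) ⟨C, fun z ↦ hC (f z)⟩ δ hδ
  obtain ⟨n, hn, hnM⟩ := (hsep.and_eventually (hM r hr.1 s hs)).exists
  exact (hrs _ _ hnM).not_ge hn
end
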